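/- Let n ≥ 1 and t > 0. Let g : ℝⁿ → ℝ be smooth with compact support contained in the closed half-space {xₙ ≥ 0} (no boundary condition required). Then for every x ∈ ℝⁿ₊, ∂ₙ(F(t)g)(x) = E(t)(∂ₙg)(x). -/

import Mathlib

open MeasureTheory ENNReal

noncomputable section

/-- Points of `ℝⁿ` with `n = m + 1`, written as pairs `x = (x′, xₙ)`. -/
abbrev HalfSpacePt (m : ℕ) := (Fin m → ℝ) × ℝ

/-- The Gauss kernel `G_t(x) = (4πt)^{-n/2} exp(-|x|²/(4t))` in dimension `n = m + 1`. -/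
def gauss (m : ℕ) (t : ℝ) (x : HalfSpacePt m) : ℝ :=
  (4 * Real.pi * t) ^ (-((m : ℝ) + 1) / 2) *
    Real.exp (-((∑ i, x.1 i ^ 2) + x.2 ^ 2) / (4 * t))

/-- The open upper half-space `ℝⁿ₊ = {x : xₙ > 0}`. -/
def halfSpace (m : ℕ) : Set (HalfSpacePt m) := {x | 0 < x.2}

/-- The Dirichlet heat operator
`E(t)f(x) = ∫_{ℝⁿ₊} [G_t(x′−y′, xₙ−yₙ) − G_t(x′−y′, xₙ+yₙ)] f(y) dy`. -/
def Eheat (m : ℕ) (t : ℝ) (f : HalfSpacePt m → ℝ) (x : HalfSpacePt m) : ℝ :=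
  ∫ y in halfSpace m,
    (gauss m t (x.1 - y.1, x.2 - y.2) - gauss m t (x.1 - y.1, x.2 + y.2)) * f y

/-- The Neumann heat operator
`F(t)f(x) = ∫_{ℝⁿ₊} [G_t(x′−y′, xₙ−yₙ) + G_t(x′−y′, xₙ+yₙ)] f(y) dy`. -/
def Fheat (m : ℕ) (t : ℝ) (f : HalfSpacePt m → ℝ) (x : HalfSpacePt m) : ℝ :=
  ∫ y in halfSpace m,
    (gauss m t (x.1 - y.1, x.2 - y.2) + gauss m t (x.1 - y.1, x.2 + y.2)) * f y

/-- The Neumann potential operator `𝒩f(x) = ∫₀^∞ F(τ)f(x) dτ`. -/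
def neumannPotential (m : ℕ) (f : HalfSpacePt m → ℝ) (x : HalfSpacePt m) : ℝ :=
  ∫ τ in Set.Ioi (0 : ℝ), Fheat m τ f x

/-- `∂_{xₙ} G_t`, the partial derivative of the Gauss kernel in the last coordinate. -/
def gaussDn (m : ℕ) (t : ℝ) (z : HalfSpacePt m) : ℝ :=
  deriv (fun w => gauss m t (z.1, w)) z.2

/-- The `i`-th standard coordinate vector of `ℝⁿ`, `n = m + 1` (the case `i = n`
being the inward normal direction `eₙ`). -/
def coordVec (m : ℕ) (i : Fin (m + 1)) : HalfSpacePt m :=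
  if h : (i : ℕ) < m then (Pi.single ⟨i, h⟩ 1, 0) else (0, 1)

/-- Reflection of the last coordinate. -/
def lastReflection (m : ℕ) : HalfSpacePt m ≃L[ℝ] HalfSpacePt m :=
  (ContinuousLinearEquiv.refl ℝ (Fin m → ℝ)).prodCongr (ContinuousLinearEquiv.neg ℝ)

lemma lastReflection_apply (m : ℕ) (y : HalfSpacePt m) :
    lastReflection m y = (y.1, -y.2) := rfl

lemma measurePreserving_lastReflection (m : ℕ) :
    MeasurePreserving (lastReflection m) volume volume :=
  (MeasurePreserving.id (volume : Measure (Fin m → ℝ))).prod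
    (Measure.measurePreserving_neg (volume : Measure ℝ))

lemma integral_comp_lastReflection (m : ℕ) (f : HalfSpacePt m → ℝ) :
    ∫ y, f (lastReflection m y) = ∫ y, f y :=
  (measurePreserving_lastReflection m).integral_comp
    (lastReflection m).toHomeomorph.measurableEmbedding f

lemma continuous_gauss (m : ℕ) (t : ℝ) : Continuous (gauss m t) := by
  unfold gauss
  fun_prop

/-- A continuous function vanishing below the hyperplane `xₙ = 0` also vanishes on it. -/
lemma eq_zero_of_snd_nonpos {m : ℕ} {f : HalfSpacePt m → ℝ} (hf : Continuous f)
    (hneg : ∀ y : HalfSpacePt m, y.2 < 0 → f y = 0) (y : HalfSpacePt m) (hy : y.2 ≤ 0) :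
    f y = 0 := by
  have hmem : y ∈ closure (Prod.snd ⁻¹' Set.Iio (0 : ℝ) : Set (HalfSpacePt m)) := by
    rw [← isOpenMap_snd.preimage_closure_eq_closure_preimage continuous_snd, closure_Iio]
    exact hy
  exact closure_minimal (t := f ⁻¹' {0}) (fun z hz => hneg z hz)
    (isClosed_singleton.preimage hf) hmem

lemma setIntegral_halfSpace_mul_eq {m : ℕ} {f : HalfSpacePt m → ℝ} (hf : Continuous f)
    (hneg : ∀ y : HalfSpacePt m, y.2 < 0 → f y = 0) (k : HalfSpacePt m → ℝ) :
    ∫ y in halfSpace m, k y * f y = ∫ y, k y * f y := by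
  refine setIntegral_eq_integral_of_forall_compl_eq_zero fun y hy => ?_
  rw [eq_zero_of_snd_nonpos hf hneg y (not_lt.mp hy), mul_zero]

lemma integrable_gauss_comp_mul {m : ℕ} (t : ℝ) {f : HalfSpacePt m → ℝ} (hf : Continuous f)
    (hfc : HasCompactSupport f) {φ : HalfSpacePt m → HalfSpacePt m} (hφ : Continuous φ) :
    Integrable fun y => gauss m t (φ y) * f y :=
  (((continuous_gauss m t).comp hφ).mul hf).integrable_of_hasCompactSupport hfc.mul_left

/-- The whole-space heat flow commutes with the derivative in the last coordinate, on
compactly supported `C¹` functions. -/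
lemma hasDerivAt_integral_gauss_mul {m : ℕ} (t : ℝ) {f : HalfSpacePt m → ℝ}
    (hf : ContDiff ℝ 1 f) (hfc : HasCompactSupport f) (x : HalfSpacePt m) :
    HasDerivAt (fun z : ℝ => ∫ y, gauss m t (x.1 - y.1, z - y.2) * f y)
      (∫ y, gauss m t (x.1 - y.1, x.2 - y.2) * fderiv ℝ f y (0, 1)) x.2 := by
  have hG : LocallyIntegrable (gauss m t) (volume : Measure (HalfSpacePt m)) :=
    (continuous_gauss m t).locallyIntegrable
  have : (volume : Measure (HalfSpacePt m)).IsAddHaarMeasure :=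
    Measure.prod.instIsAddHaarMeasure _ _
  have hconv := hfc.hasFDerivAt_convolution_left (ContinuousLinearMap.mul ℝ ℝ) hf hG x
  have hline : HasDerivAt (fun z : ℝ => ((x.1, z) : HalfSpacePt m)) (0, 1) x.2 :=
    (hasDerivAt_const _ _).prodMk (hasDerivAt_id _)
  have hderiv := HasFDerivAt.comp_hasDerivAt (x := x.2) (f := fun z : ℝ => (x.1, z)) hconv hline
  have hexists := (hfc.fderiv ℝ).convolutionExists_left
    ((ContinuousLinearMap.mul ℝ ℝ).precompL (HalfSpacePt m)) (hf.continuous_fderiv one_ne_zero)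
    hG x
  refine (hderiv.congr_of_eventuallyEq (.of_forall fun z => ?_)).congr_deriv ?_
  · exact integral_congr_ae (.of_forall fun y => mul_comm _ _)
  · rw [convolution_def, ContinuousLinearMap.integral_apply hexists]
    exact integral_congr_ae (.of_forall fun y => mul_comm _ _)

/-- for `t > 0` and `g` smooth with compact support contained in the
closed half-space `{xₙ ≥ 0}` (no boundary condition), for every `x ∈ ℝⁿ₊`,
`∂ₙ(F(t)g)(x) = E(t)(∂ₙg)(x)` (`n = m + 1`). -/
theorem normalDeriv_Fheat_eq_Eheat (m : ℕ) (t : ℝ) (ht : 0 < t)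
    (g : HalfSpacePt m → ℝ) (hg : ContDiff ℝ (⊤ : ℕ∞) g) (hgc : HasCompactSupport g)
    (hgs : tsupport g ⊆ {x : HalfSpacePt m | 0 ≤ x.2})
    (x : HalfSpacePt m) (hx : x ∈ halfSpace m) :
    HasDerivAt (fun z : ℝ => Fheat m t g (x.1, z))
      (Eheat m t (fun y => fderiv ℝ g y (0, 1)) x) x.2 := by
  have hg1 : ContDiff ℝ 1 g := hg.of_le (by exact_mod_cast le_top)
  have hg' : Continuous fun y => fderiv ℝ g y (0, 1) :=
    (hg1.continuous_fderiv one_ne_zero).clm_apply continuous_const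
  have hgc' : HasCompactSupport fun y => fderiv ℝ g y (0, 1) := hgc.fderiv_apply ℝ _
  have hneg : ∀ y : HalfSpacePt m, y.2 < 0 → y ∉ tsupport g :=
    fun y hy hmem => (hgs hmem).not_gt hy
  have hneg' : ∀ y : HalfSpacePt m, y.2 < 0 → fderiv ℝ g y (0, 1) = 0 := fun y hy => by
    rw [fderiv_of_notMem_tsupport ℝ (hneg y hy), zero_apply]
  have hrefl := hasDerivAt_integral_gauss_mul t (f := g ∘ lastReflection m)
    (hg1.comp (lastReflection m).contDiff)
    (hgc.comp_homeomorph (lastReflection m).toHomeomorph) x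
  have hsum := (hasDerivAt_integral_gauss_mul t hg1 hgc x).add hrefl
  refine (hsum.congr_of_eventuallyEq (.of_forall fun z => ?_)).congr_deriv ?_
  · simp only [Fheat, Pi.add_apply]
    rw [setIntegral_halfSpace_mul_eq hg1.continuous
      (fun y hy => image_eq_zero_of_notMem_tsupport (hneg y hy)),
      ← integral_comp_lastReflection m fun y =>
        gauss m t (x.1 - y.1, z - y.2) * (g ∘ lastReflection m) y,
      ← integral_add (integrable_gauss_comp_mul t hg1.continuous hgc (by fun_prop))]
    · simp [lastReflection_apply, add_mul]
    · simpa [lastReflection_apply] using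
        integrable_gauss_comp_mul t hg1.continuous hgc
          (φ := fun y => (x.1 - y.1, z + y.2)) (by fun_prop)
  · have hfderiv : ∀ y, fderiv ℝ (g ∘ lastReflection m) y (0, 1) =
        -fderiv ℝ g (lastReflection m y) (0, 1) := fun y => by
      rw [(lastReflection m).comp_right_fderiv, ← map_neg]
      simp [lastReflection_apply]
    simp only [Eheat, hfderiv]
    rw [setIntegral_halfSpace_mul_eq hg' hneg',
      ← integral_comp_lastReflection m fun y =>
        gauss m t (x.1 - y.1, x.2 - y.2) * -fderiv ℝ g (lastReflection m y) (0, 1),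
      ← integral_add (integrable_gauss_comp_mul t hg' hgc' (by fun_prop))]
    · simp [lastReflection_apply, sub_eq_add_neg, add_mul]
    · simpa [lastReflection_apply] using
        (integrable_gauss_comp_mul t hg' hgc'
          (φ := fun y => (x.1 - y.1, x.2 + y.2)) (by fun_prop)).neg

end
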